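/- Let G be a finite abelian group and let F be an injective group cellular automaton on G. Then F is expansive if and only if the group cellular automaton H = F − F^{−1} on G (defined pointwise by H(c) = F(c) − F^{−1}(c)) is positively expansive. -/

import Mathlib

open Function Topology

/-- The prodiscrete (product of discrete) topology on configurations `ℤ → A`. -/
def configTop (A : Type*) : TopologicalSpace (ℤ → A) :=
  @Pi.topologicalSpace ℤ (fun _ => A) (fun _ => ⊥)

/-- The shift map. -/
def shiftMap (A : Type*) : (ℤ → A) → (ℤ → A) := fun c i => c (i + 1)

open Classical in
/-- The Tychonoff distance on configurations. -/
noncomputable def tychDist {A : Type*} (c c' : ℤ → A) : ℝ :=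
  if c = c' then 0
  else (2 : ℝ) ^ (-((sInf {n : ℕ | ∃ j : ℤ, j.natAbs = n ∧ c j ≠ c' j} : ℕ) : ℤ))

/-- The `n`-th iterate, `n ∈ ℤ`, of a map (negative powers via `Function.invFun`,
which is the genuine inverse whenever the map is bijective). -/
noncomputable def zIter {A : Type*} [Nonempty A] (F : (ℤ → A) → (ℤ → A)) (n : ℤ) :
    (ℤ → A) → (ℤ → A) :=
  if 0 ≤ n then F^[n.toNat] else (Function.invFun F)^[(-n).toNat]

/-- Expansivity (for reversible maps). -/
def Expansive {A : Type*} [Nonempty A] (F : (ℤ → A) → (ℤ → A)) : Prop :=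
  ∃ ε : ℝ, 0 < ε ∧ ∀ c c' : ℤ → A, c ≠ c' →
    ∃ n : ℤ, tychDist (zIter F n c) (zIter F n c') > ε

/-- Positive expansivity. -/
def PosExpansive {A : Type*} (F : (ℤ → A) → (ℤ → A)) : Prop :=
  ∃ ε : ℝ, 0 < ε ∧ ∀ c c' : ℤ → A, c ≠ c' →
    ∃ n : ℕ, tychDist (F^[n] c) (F^[n] c') > ε

/-- Topological transitivity (w.r.t. the prodiscrete topology). -/
def TopTransitive {A : Type*} (F : (ℤ → A) → (ℤ → A)) : Prop :=
  ∀ U V : Set (ℤ → A), IsOpen[configTop A] U → IsOpen[configTop A] V →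
    U.Nonempty → V.Nonempty → ∃ n : ℕ, (F^[n] '' U ∩ V).Nonempty

/-- Left fronts (additive). -/
def Lset (G : Type*) [Zero G] (k : ℤ) : Set (ℤ → G) := {c | c k ≠ 0 ∧ ∀ i > k, c i = 0}

section Orbits

variable {A : Type*} [AddCommGroup A] (f : A ≃+ A)

theorem iterate_sub_symm_mem (W : AddSubgroup A) (n : ℕ) :
    ∀ c : A, (∀ k : ℕ, f^[k] c ∈ W) → (∀ k : ℕ, f.symm^[k] c ∈ W) →
      (fun x => f x - f.symm x)^[n] c ∈ W := by
  induction n with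
  | zero => intro c h _; exact h 0
  | succ n ih =>
    intro c h h'
    rw [iterate_succ_apply]
    refine ih _ (fun k => ?_) (fun k => ?_)
    · rw [iterate_map_sub]
      refine W.sub_mem (h (k + 1)) ?_
      cases k with
      | zero => exact h' 1
      | succ k => simpa using h k
    · rw [iterate_map_sub]
      refine W.sub_mem ?_ (h' (k + 1))
      cases k with
      | zero => exact h 1
      | succ k => simpa using h' k

/-- Since `f ^ 2 = f * (f - f⁻¹) + 1`, the `f`-orbit of `c` lies in `K + f K`, where `K` is the
subgroup generated by the orbit of `c` under `f - f⁻¹`. -/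
theorem iterate_mem_of_iterate_sub_symm_mem (W V : AddSubgroup A) (hWV : W ≤ V)
    (hf : ∀ x ∈ W, f x ∈ V) (c : A)
    (hc : ∀ n : ℕ, (fun x => f x - f.symm x)^[n] c ∈ W) :
    (∀ n : ℕ, f^[n] c ∈ V) ∧ ∀ n : ℕ, f.symm^[n] c ∈ V := by
  let h : A →+ A := f.toAddMonoidHom - f.symm.toAddMonoidHom
  have hh (x : A) : h x = f x - f.symm x := rfl
  have hc' (n : ℕ) : h^[n] c ∈ W := hc n
  have hcomm (x : A) : f (h x) = h (f x) := by simp [hh]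
  let K : AddSubgroup A :=
    { carrier := {x | ∀ n : ℕ, h^[n] x ∈ W}
      add_mem' := fun {a b} ha hb n => by
        rw [iterate_map_add]; exact W.add_mem (ha n) (hb n)
      zero_mem' := fun n => by rw [iterate_map_zero]; exact W.zero_mem
      neg_mem' := fun {a} ha n => by rw [iterate_map_neg]; exact W.neg_mem (ha n) }
  have hK : ∀ x ∈ K, h x ∈ K := fun x hx n => hx (n + 1)
  let L : AddSubgroup A := K ⊔ K.map f.toAddMonoidHom
  have memL (x : A) : x ∈ L ↔ ∃ a ∈ K, ∃ b ∈ K, a + f b = x := by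
    simp [L, AddSubgroup.mem_sup]
  have hcL : c ∈ L := (memL c).2 ⟨c, hc', 0, K.zero_mem, by simp⟩
  have hLV : ∀ x ∈ L, x ∈ V := by
    intro x hx
    obtain ⟨a, ha, b, hb, rfl⟩ := (memL x).1 hx
    exact V.add_mem (hWV (ha 0)) (hf b (hb 0))
  have hfL : ∀ x ∈ L, f x ∈ L := by
    intro x hx
    obtain ⟨a, ha, b, hb, rfl⟩ := (memL x).1 hx
    refine (memL _).2 ⟨b, hb, a + h b, K.add_mem ha (hK b hb), ?_⟩
    have hfh : f (h b) = f (f b) - b := by rw [hh, map_sub, f.apply_symm_apply]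
    rw [map_add, map_add, hfh]
    abel
  have hsL : ∀ x ∈ L, f.symm x ∈ L := by
    intro x hx
    have hx' : h x ∈ L := by
      obtain ⟨a, ha, b, hb, rfl⟩ := (memL x).1 hx
      exact (memL _).2 ⟨h a, hK a ha, h b, hK b hb, by rw [map_add, hcomm]⟩
    have : f.symm x = f x - h x := by rw [hh]; abel
    rw [this]
    exact L.sub_mem (hfL x hx) hx'
  have orbit (g : A → A) (hg : ∀ x ∈ L, g x ∈ L) (n : ℕ) : g^[n] c ∈ V :=
    hLV _ ((show Set.MapsTo g (L : Set A) L from hg).iterate n hcL)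
  exact ⟨orbit f hfL, orbit f.symm hsL⟩

end Orbits

section Windows

theorem tychDist_le_of_forall_eq {A : Type*} {ε : ℝ} (hε : 0 < ε) :
    ∃ M : ℕ, ∀ c c' : ℤ → A, (∀ j : ℤ, j.natAbs ≤ M → c j = c' j) → tychDist c c' ≤ ε := by
  obtain ⟨M, hM⟩ := exists_pow_lt_of_lt_one hε (by norm_num : (1 / 2 : ℝ) < 1)
  refine ⟨M, fun c c' h => ?_⟩
  unfold tychDist
  split_ifs with hcc
  · exact hε.le
  · refine le_trans ?_ hM.le
    obtain ⟨i, hi⟩ := Function.ne_iff.1 hcc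
    have hle : M ≤ sInf {n : ℕ | ∃ j : ℤ, j.natAbs = n ∧ c j ≠ c' j} := by
      refine le_csInf ⟨i.natAbs, i, rfl, hi⟩ ?_
      rintro n ⟨j, rfl, hj⟩
      by_contra! hlt
      exact hj (h j hlt.le)
    rw [zpow_neg, zpow_natCast, one_div, inv_pow]
    gcongr
    norm_num

theorem tychDist_gt_of_ne {A : Type*} {c c' : ℤ → A} {M : ℕ} {j : ℤ} (hj : j.natAbs ≤ M)
    (hne : c j ≠ c' j) : (2 : ℝ) ^ (-((M + 1 : ℕ) : ℤ)) < tychDist c c' := by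
  unfold tychDist
  rw [if_neg (fun h => hne (congrFun h j))]
  have hle : sInf {n : ℕ | ∃ j : ℤ, j.natAbs = n ∧ c j ≠ c' j} ≤ M :=
    le_trans (Nat.sInf_le (show j.natAbs ∈ {n : ℕ | ∃ j : ℤ, j.natAbs = n ∧ c j ≠ c' j} from
      ⟨j, rfl, hne⟩)) hj
  apply zpow_lt_zpow_right₀ (by norm_num)
  omega

variable {G : Type*} [AddCommGroup G]

/-- The configurations vanishing at all positions of absolute value at most `M`. -/
def windowKer (G : Type*) [AddCommGroup G] (M : ℕ) : AddSubgroup (ℤ → G) where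
  carrier := {c | ∀ j : ℤ, j.natAbs ≤ M → c j = 0}
  add_mem' := fun {a b} ha hb j hj => by simp [ha j hj, hb j hj]
  zero_mem' := fun _ _ => rfl
  neg_mem' := fun {a} ha j hj => by simp [ha j hj]

theorem mem_windowKer {M : ℕ} {c : ℤ → G} :
    c ∈ windowKer G M ↔ ∀ j : ℤ, j.natAbs ≤ M → c j = 0 := Iff.rfl

theorem windowKer_anti {M N : ℕ} (h : M ≤ N) : windowKer G N ≤ windowKer G M :=
  fun _ hc j hj => hc j (hj.trans h)

/-- For a family of additive maps, uniform separation of points amounts to the existence of a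
window on which no nonzero configuration has all its images vanishing. -/
theorem exists_tychDist_gt_iff {ι : Type*} (φ : ι → (ℤ → G) → (ℤ → G))
    (hφ : ∀ i c c', φ i (c - c') = φ i c - φ i c') :
    (∃ ε : ℝ, 0 < ε ∧ ∀ c c' : ℤ → G, c ≠ c' → ∃ i, tychDist (φ i c) (φ i c') > ε) ↔
      ∃ M : ℕ, ∀ c : ℤ → G, (∀ i, φ i c ∈ windowKer G M) → c = 0 := by
  constructor
  · rintro ⟨ε, hε, h⟩
    obtain ⟨M, hM⟩ := tychDist_le_of_forall_eq (A := G) hε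
    refine ⟨M, fun c hc => ?_⟩
    by_contra hne
    obtain ⟨i, hi⟩ := h c 0 hne
    have h0 : φ i 0 = 0 := by simpa using hφ i 0 0
    refine absurd (hM _ _ fun j hj => ?_) hi.not_ge
    rw [hc i j hj, h0, Pi.zero_apply]
  · rintro ⟨M, hM⟩
    refine ⟨_, zpow_pos (by norm_num : (0 : ℝ) < 2) (-((M + 1 : ℕ) : ℤ)), fun c c' hne => ?_⟩
    by_contra! hcon
    refine hne (sub_eq_zero.1 (hM _ fun i j hj => ?_))
    rw [hφ, Pi.sub_apply, sub_eq_zero]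
    by_contra hne'
    exact (tychDist_gt_of_ne hj hne').not_ge (hcon i)

end Windows

section CellularAutomata

theorem shiftMap_iterate {A : Type*} (n : ℕ) (c : ℤ → A) (i : ℤ) :
    (shiftMap A)^[n] c i = c (i + n) := by
  induction n generalizing c i with
  | zero => simp
  | succ n ih =>
    rw [iterate_succ_apply, ih]
    simp only [shiftMap]
    congr 1
    push_cast
    ring

/-- An injective cellular automaton permutes each finite set of periodic configurations, and the
periodic configurations are dense. -/
theorem surjective_of_injective_of_comm_shiftMap {A : Type*} [Finite A]
    {F : (ℤ → A) → (ℤ → A)} (hcont : Continuous[configTop A, configTop A] F)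
    (hshift : F ∘ shiftMap A = shiftMap A ∘ F) (hinj : Function.Injective F) :
    Function.Surjective F := by
  let _ : TopologicalSpace A := ⊥
  have : DiscreteTopology A := ⟨rfl⟩
  have hF : Continuous F := hcont
  have hclosed : IsClosed (Set.range F) := (isCompact_range hF).isClosed
  have hper (n : ℕ) (hn : 0 < n) (p : ℤ → A) (hp : (shiftMap A)^[n] p = p) :
      p ∈ Set.range F := by
    let P : Set (ℤ → A) := {q | (shiftMap A)^[n] q = q}
    have hmaps : Set.MapsTo F P P := fun q hq => by
      have := (show Function.Semiconj F (shiftMap A) (shiftMap A) from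
        fun x => congrFun hshift x).iterate_right n q
      rw [show (shiftMap A)^[n] q = q from hq] at this
      exact this.symm
    have hmod (q : ℤ → A) (hq : q ∈ P) (i : ℤ) : q i = q (i % n) := by
      have hq' (i : ℤ) : q (i + n) = q i := by
        rw [← shiftMap_iterate n q, show (shiftMap A)^[n] q = q from hq]
      have hqp : Function.Periodic q (n : ℤ) := hq'
      conv_lhs => rw [← Int.emod_add_mul_ediv i n, mul_comm]
      exact hqp.int_mul (i / n) (i % n)
    have hfin : P.Finite := by
      have hinjP : Set.InjOn (fun (q : ℤ → A) (k : Fin n) => q (k : ℕ)) P := by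
        intro q hq q' hq' h
        funext i
        rw [hmod q hq, hmod q' hq']
        have h0 : 0 ≤ i % n := Int.emod_nonneg _ (by omega)
        have h1 : i % n < n := Int.emod_lt_of_pos _ (by omega)
        have := congrFun h ⟨(i % n).toNat, by omega⟩
        simpa [Int.toNat_of_nonneg h0] using this
      exact Set.Finite.of_injOn (Set.mapsTo_univ _ _) hinjP Set.finite_univ
    have := hfin.to_subtype
    obtain ⟨q, hq⟩ := Finite.surjective_of_injective
      (hmaps.restrict_inj.2 hinj.injOn) ⟨p, hp⟩
    exact ⟨q, congrArg Subtype.val hq⟩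
  intro c
  let p : ℕ → ℤ → A := fun M i => c ((i + M) % (2 * M + 1 : ℕ) - M)
  have hpr (M : ℕ) : p M ∈ Set.range F := by
    refine hper (2 * M + 1) (by omega) _ ?_
    funext i
    rw [shiftMap_iterate]
    simp only [p]
    rw [add_right_comm, Int.add_emod_right]
  have hlim : Filter.Tendsto p Filter.atTop (𝓝 c) := by
    rw [tendsto_pi_nhds]
    intro i
    refine tendsto_const_nhds.congr' ?_
    filter_upwards [Filter.eventually_ge_atTop i.natAbs] with M hM
    simp only [p]
    rw [Int.emod_eq_of_lt (by omega) (by omega), add_sub_cancel_right]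
  exact hclosed.mem_of_tendsto hlim (Filter.Eventually.of_forall hpr)

theorem map_shift_apply {A : Type*} {F : (ℤ → A) → (ℤ → A)}
    (hshift : F ∘ shiftMap A = shiftMap A ∘ F) (c : ℤ → A) (k i : ℤ) :
    F (fun j => c (j + k)) i = F c (i + k) := by
  have hnat (n : ℕ) (c : ℤ → A) (i : ℤ) : F (fun j => c (j + n)) i = F c (i + n) := by
    have := (show Function.Semiconj F (shiftMap A) (shiftMap A) from
      fun x => congrFun hshift x).iterate_right n c
    rw [← shiftMap_iterate n (F c), ← this]
    congr 1
    funext j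
    rw [shiftMap_iterate]
  obtain ⟨n, rfl | rfl⟩ := k.eq_nat_or_neg
  · exact hnat n c i
  · have := hnat n (fun j => c (j + -n)) (i + -n)
    simpa using this.symm

variable {G : Type*} [AddCommGroup G]

theorem exists_radius {F : (ℤ → G) → (ℤ → G)}
    (hcont : Continuous[configTop G, configTop G] F)
    (hshift : F ∘ shiftMap G = shiftMap G ∘ F) (h0 : F 0 = 0) :
    ∃ r : ℕ, ∀ M : ℕ, ∀ c ∈ windowKer G (M + r), F c ∈ windowKer G M := by
  let _ : TopologicalSpace G := ⊥
  have : DiscreteTopology G := ⟨rfl⟩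
  have hF : Continuous F := hcont
  have hopen : IsOpen {c : ℤ → G | F c 0 = 0} :=
    (isOpen_discrete {(0 : G)}).preimage ((continuous_apply (0 : ℤ)).comp hF)
  obtain ⟨I, u, hu, hsub⟩ := isOpen_pi_iff.1 hopen 0 (by simp [h0])
  refine ⟨I.sup Int.natAbs, fun M c hc k hk => ?_⟩
  have : (fun j => c (j + k)) ∈ {c : ℤ → G | F c 0 = 0} := by
    apply hsub
    intro j hj
    have hj' : j.natAbs ≤ I.sup Int.natAbs := Finset.le_sup (f := Int.natAbs) hj
    have : c (j + k) = 0 := hc _ (by omega)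
    change c (j + k) ∈ u j
    rw [this]
    exact (hu j hj).2
  simpa [map_shift_apply hshift] using this

end CellularAutomata

theorem zIter_sub {G : Type*} [AddCommGroup G] (f : (ℤ → G) ≃+ (ℤ → G))
    (hinv : Function.invFun f = f.symm) (n : ℤ) (c c' : ℤ → G) :
    zIter f n (c - c') = zIter f n c - zIter f n c' := by
  unfold zIter
  rw [hinv]
  split_ifs <;> exact iterate_map_sub _ _ _ _

theorem forall_zIter_mem_iff {G : Type*} [AddCommGroup G] (f : (ℤ → G) ≃+ (ℤ → G))
    (hinv : Function.invFun f = f.symm) (W : AddSubgroup (ℤ → G)) (c : ℤ → G) :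
    (∀ n : ℤ, zIter f n c ∈ W) ↔ (∀ n : ℕ, f^[n] c ∈ W) ∧ ∀ n : ℕ, f.symm^[n] c ∈ W := by
  unfold zIter
  rw [hinv]
  constructor
  · refine fun h => ⟨fun n => by simpa using h n, fun n => ?_⟩
    cases n with
    | zero => simpa using h 0
    | succ n =>
      have := h (-((n + 1 : ℕ) : ℤ))
      rwa [if_neg (by omega), neg_neg, Int.toNat_natCast] at this
  · rintro ⟨h, h'⟩ n
    split_ifs
    · exact h _
    · exact h' _

/-- for an injective GCA `F` on a finite abelian group, `F` is expansive iff
`H = F - F⁻¹` is positively expansive. -/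
theorem expansive_iff_posExpansive_sub_inv {G : Type*} [AddCommGroup G] [Fintype G]
    (F : (ℤ → G) → (ℤ → G))
    (hcont : Continuous[configTop G, configTop G] F)
    (hshift : F ∘ shiftMap G = shiftMap G ∘ F)
    (hhom : ∀ c c' : ℤ → G, F (c + c') = F c + F c')
    (hinj : Function.Injective F) :
    Expansive F ↔ PosExpansive (fun c => F c - Function.invFun F c) := by
  have hsurj := surjective_of_injective_of_comm_shiftMap hcont hshift hinj
  obtain ⟨f, rfl⟩ : ∃ f : (ℤ → G) ≃+ (ℤ → G), F = f :=
    ⟨AddEquiv.ofBijective (AddMonoidHom.mk' F hhom) ⟨hinj, hsurj⟩, rfl⟩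
  have hinv : Function.invFun f = f.symm :=
    funext fun c => hinj (by rw [Function.rightInverse_invFun hsurj, f.apply_symm_apply])
  have hexp := exists_tychDist_gt_iff (zIter f) (zIter_sub f hinv)
  have hpos := exists_tychDist_gt_iff (fun n : ℕ => (fun c => f c - f.symm c)^[n])
    (fun n c c' => iterate_map_sub (f.toAddMonoidHom - f.symm.toAddMonoidHom) n c c')
  rw [hinv]
  unfold Expansive PosExpansive
  rw [hexp, hpos]
  constructor
  · rintro ⟨M, hM⟩
    obtain ⟨r, hr⟩ := exists_radius hcont hshift (map_zero f)
    refine ⟨M + r, fun c hc => hM c ?_⟩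
    rw [forall_zIter_mem_iff f hinv]
    exact iterate_mem_of_iterate_sub_symm_mem f _ _ (windowKer_anti (Nat.le_add_right M r))
      (hr M) c hc
  · rintro ⟨M, hM⟩
    refine ⟨M, fun c hc => hM c fun n => ?_⟩
    rw [forall_zIter_mem_iff f hinv] at hc
    exact iterate_sub_symm_mem f _ n c hc.1 hc.2
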